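/- arXiv:1501.00076 — 4 statements merged into one kernel-verified Lean document; each statement's English description precedes it below -/
import Mathlib

section
/- Let k > 1 and let n be a positive integer with remainder r when divided by k-1. Then any n-point subset V of the real line contains at most (n-r)(n+r-k+1)/(2(k-1)) k-term arithmetic progressions. -/
attribute [local instance] Classical.propDecidable

theorem ap_arith (m q r : ℕ) (hm : 0 < m) (hr : r < m) :
    ∑ t ∈ Finset.range m, (((t + 1) * q + min (t + 1) r) - (t * q + min t r)).choose 2
      ≤ (m * q + r - r) * (m * q + r + r + 1 - (m + 1)) / (2 * m) := by
  have h1 : ∀ t ∈ Finset.range m,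
      (((t + 1) * q + min (t + 1) r) - (t * q + min t r)).choose 2
        = q.choose 2 + (if t < r then q else 0) := by
    intro t _
    have e : (t + 1) * q = t * q + q := by ring
    split_ifs with h
    · have : ((t + 1) * q + min (t + 1) r) - (t * q + min t r) = q + 1 := by
        rw [e, min_eq_left (by omega), min_eq_left (by omega)]; omega
      rw [this, Nat.choose_succ_succ' q 1]; simp [add_comm]
    · have : ((t + 1) * q + min (t + 1) r) - (t * q + min t r) = q := by
        rw [e, min_eq_right (by omega), min_eq_right (by omega)]; omega
      rw [this, add_zero]
  rw [Finset.sum_congr rfl h1, Finset.sum_add_distrib, ← Finset.sum_filter]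
  have h2 : (Finset.range m).filter (fun t => t < r) = Finset.range r := by
    ext t; simp; omega
  rw [h2]
  simp only [Finset.sum_const, Finset.card_range, smul_eq_mul]
  rw [Nat.le_div_iff_mul_le (by omega)]
  rcases q with _ | p
  · simp
  · have e1 : m * (p + 1) + r - r = m * (p + 1) := by omega
    have e2 : m * (p + 1) + r + r + 1 - (m + 1) = m * p + 2 * r := by
      have : m * (p + 1) = m * p + m := by ring
      omega
    have e3 : (p + 1).choose 2 * 2 = (p + 1) * p := by
      rw [Nat.choose_two_right]
      exact Nat.div_mul_cancel (Nat.even_mul_pred_self (p + 1)).two_dvd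
    rw [e1, e2]
    apply le_of_eq
    calc (m * (p + 1).choose 2 + r * (p + 1)) * (2 * m)
        = m * (m * ((p + 1).choose 2 * 2)) + 2 * r * (p + 1) * m := by ring
      _ = _ := by rw [e3]; ring

theorem ap_key (m n : ℕ) (hm : 0 < m) (s : ℕ → ℕ) (hs0 : s 0 = 0) (hsm : s m = n)
    (V : Finset ℝ) (hV : V.card = n) :
    ((V.powersetCard (m + 1)).filter
        (fun P => ∃ a d : ℝ, 0 < d ∧
          P = (Finset.range (m + 1)).image (fun i => a + (i : ℝ) * d))).card
      ≤ ∑ t ∈ Finset.range m, (s (t + 1) - s t).choose 2 := by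
  let rk : ℝ → ℕ := fun x => (V.filter (fun y => y < x)).card
  have hmono : ∀ x ∈ V, ∀ y, x < y → rk x < rk y := by
    intro x hx y hxy
    apply Finset.card_lt_card
    rw [Finset.ssubset_iff_of_subset]
    · exact ⟨x, by simp [hx, hxy], by simp⟩
    · intro z hz
      simp only [Finset.mem_filter] at hz ⊢
      exact ⟨hz.1, hz.2.trans hxy⟩
  have hinj : ∀ x ∈ V, ∀ y ∈ V, rk x = rk y → x = y := by
    intro x hx y hy h
    rcases lt_trichotomy x y with h' | h' | h'
    · have := hmono x hx y h'; omega
    · exact h'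
    · have := hmono y hy x h'; omega
  have hlt : ∀ x ∈ V, rk x < n := by
    intro x hx
    rw [← hV]
    apply Finset.card_lt_card
    rw [Finset.ssubset_iff_of_subset (Finset.filter_subset _ _)]
    exact ⟨x, hx, by simp⟩
  have hex : ∀ P ∈ ((V.powersetCard (m + 1)).filter
        (fun P => ∃ a d : ℝ, 0 < d ∧
          P = (Finset.range (m + 1)).image (fun i => a + (i : ℝ) * d))),
      ∃ (a d : ℝ) (t : ℕ), 0 < d ∧
        P = (Finset.range (m + 1)).image (fun i => a + (i : ℝ) * d) ∧ t < m ∧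
        a + (t : ℝ) * d ∈ V ∧ a + ((t + 1 : ℕ) : ℝ) * d ∈ V ∧
        s t ≤ rk (a + (t : ℝ) * d) ∧ rk (a + ((t + 1 : ℕ) : ℝ) * d) < s (t + 1) := by
    intro P hP
    rw [Finset.mem_filter, Finset.mem_powersetCard] at hP
    obtain ⟨⟨hPV, _⟩, a, d, hd, hPe⟩ := hP
    have hmem : ∀ i, i ≤ m → a + (i : ℝ) * d ∈ V := by
      intro i hi
      apply hPV
      rw [hPe]
      refine Finset.mem_image.2 ⟨(i : ℝ), ?_, rfl⟩
      simp only [Finset.bind_def, Finset.pure_def, Finset.mem_sup, Finset.mem_singleton]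
      exact ⟨i, Finset.mem_range.2 (by omega), rfl⟩
    have hE : ∃ t, rk (a + ((t + 1 : ℕ) : ℝ) * d) < s (t + 1) := by
      refine ⟨m - 1, ?_⟩
      have : m - 1 + 1 = m := by omega
      rw [this, hsm]
      exact hlt _ (hmem m le_rfl)
    have htm : Nat.find hE ≤ m - 1 := by
      apply Nat.find_min'
      have : m - 1 + 1 = m := by omega
      rw [this, hsm]
      exact hlt _ (hmem m le_rfl)
    refine ⟨a, d, Nat.find hE, hd, hPe, by omega, hmem _ (by omega), hmem _ (by omega), ?_,
      Nat.find_spec hE⟩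
    rcases h0 : Nat.find hE with _ | u
    · rw [hs0]; exact Nat.zero_le _
    · have := Nat.find_min hE (m := u) (by omega)
      exact not_lt.1 this
  choose! A D T hD hPe hT hx hy h1 h2 using hex
  have hcard : ∑ t ∈ Finset.range m, (s (t + 1) - s t).choose 2
      = ((Finset.range m).sigma
          (fun t => (Finset.Ico (s t) (s (t + 1))).powersetCard 2)).card := by
    rw [Finset.card_sigma]
    simp
  rw [hcard]
  have hrk : ∀ P ∈ ((V.powersetCard (m + 1)).filter
        (fun P => ∃ a d : ℝ, 0 < d ∧
          P = (Finset.range (m + 1)).image (fun i => a + (i : ℝ) * d))),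
      rk (A P + (T P : ℝ) * D P) < rk (A P + ((T P + 1 : ℕ) : ℝ) * D P) := by
    intro P hP
    apply hmono _ (hx P hP)
    have := hD P hP
    push_cast
    linarith
  apply Finset.card_le_card_of_injOn
    (fun P => (⟨T P, {rk (A P + (T P : ℝ) * D P), rk (A P + ((T P + 1 : ℕ) : ℝ) * D P)}⟩ :
      (_ : ℕ) × Finset ℕ))
  · intro P hP
    have hP := Finset.mem_coe.1 hP
    have a1 := h1 P hP
    have a2 := h2 P hP
    have a3 := hrk P hP
    rw [Finset.mem_coe, Finset.mem_sigma, Finset.mem_powersetCard]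
    refine ⟨Finset.mem_range.2 (hT P hP), ?_, Finset.card_pair (by omega)⟩
    intro z hz
    simp only [Finset.mem_insert, Finset.mem_singleton] at hz
    rw [Finset.mem_Ico]
    dsimp only
    rcases hz with rfl | rfl <;> constructor <;> omega
  · intro P hP Q hQ hPQ
    have hP := Finset.mem_coe.1 hP
    have hQ := Finset.mem_coe.1 hQ
    have b1 := hrk P hP
    have b2 := hrk Q hQ
    simp only [Sigma.mk.injEq, heq_eq_eq] at hPQ
    obtain ⟨hTT, hset⟩ := hPQ
    have c1 : rk (A P + (T P : ℝ) * D P) = rk (A Q + (T Q : ℝ) * D Q) ∧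
        rk (A P + ((T P + 1 : ℕ) : ℝ) * D P) = rk (A Q + ((T Q + 1 : ℕ) : ℝ) * D Q) := by
      generalize rk (A P + (T P : ℝ) * D P) = i at *
      generalize rk (A Q + (T Q : ℝ) * D Q) = i' at *
      generalize rk (A P + ((T P + 1 : ℕ) : ℝ) * D P) = j at *
      generalize rk (A Q + ((T Q + 1 : ℕ) : ℝ) * D Q) = j' at *
      have e1 : i ∈ ({i', j'} : Finset ℕ) := by rw [← hset]; simp
      have e2 : j ∈ ({i', j'} : Finset ℕ) := by rw [← hset]; simp
      simp only [Finset.mem_insert, Finset.mem_singleton] at e1 e2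
      omega
    have x1 := hinj _ (hx P hP) _ (hx Q hQ) c1.1
    have y1 := hinj _ (hy P hP) _ (hy Q hQ) c1.2
    rw [hTT] at x1 y1
    push_cast at y1
    have hDD : D P = D Q := by linarith
    have hAA : A P = A Q := by rw [hDD] at x1; linarith
    rw [hPe P hP, hPe Q hQ, hAA, hDD]

theorem stmt_2 (k n : ℕ) (hk : 1 < k) (hn : 0 < n) (r : ℕ) (hr : r = n % (k - 1))
    (V : Finset ℝ) (hV : V.card = n) :
    ((V.powersetCard k).filter
        (fun P => ∃ a d : ℝ, 0 < d ∧
          P = (Finset.range k).image (fun i => a + (i : ℝ) * d))).card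
      ≤ (n - r) * (n + r + 1 - k) / (2 * (k - 1)) := by
  obtain ⟨m, rfl⟩ : ∃ m, k = m + 1 := ⟨k - 1, by omega⟩
  rw [Nat.add_sub_cancel] at hr ⊢
  have hm : 0 < m := by omega
  have hrm : r < m := hr ▸ Nat.mod_lt _ hm
  have hq : m * (n / m) + r = n := by rw [hr]; exact Nat.div_add_mod n m
  have key := ap_key m n hm (fun t => t * (n / m) + min t r) (by simp)
    (by rw [min_eq_right hrm.le]; exact hq) V hV
  have ar := ap_arith m (n / m) r hm hrm
  rw [hq] at ar
  exact key.trans ar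
end

section
/- Let k > 1 and let P be any fixed k-element subset of ℝ. For a finite set V ⊆ ℝ, let S(V) denote the number of subsets of V directly similar to P (i.e., of the form aP + b with a > 0). Then for any n-point set V, with r the remainder of n divided by k-1, S(V) ≤ (n-r)(n+r-k+1)/(2(k-1)). -/
attribute [local instance] Classical.propDecidable

lemma aux_enum (k : ℕ) (P : Finset ℝ) (hP : P.card = k) :
    ∃ p : ℕ → ℝ, (∀ i < k, p i ∈ P) ∧ (∀ i j, i < j → j < k → p i < p j) := by
  refine ⟨fun i => if h : i < k then P.orderEmbOfFin hP ⟨i, h⟩ else 0, ?_, ?_⟩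
  · intro i hi
    simp [hi]
  · intro i j hij hj
    have hi : i < k := by omega
    simp [hi, hj, hij]

lemma aux_sum (m q r : ℕ) (hr : r < m) :
    ∑ j ∈ Finset.range m, ∑ i ∈ Finset.range (if j < r then q + 1 else q), i
      = m * (∑ i ∈ Finset.range q, i) + r * q := by
  have h1 : ∀ j ∈ Finset.range m, ∑ i ∈ Finset.range (if j < r then q + 1 else q), i
      = (∑ i ∈ Finset.range q, i) + (if j < r then q else 0) := by
    intro j _
    split_ifs
    · rw [Finset.sum_range_succ]
    · rfl
  rw [Finset.sum_congr rfl h1, Finset.sum_add_distrib, ← Finset.sum_filter]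
  have h2 : (Finset.range m).filter (fun j => j < r) = Finset.range r := by
    ext j
    simp only [Finset.mem_filter, Finset.mem_range]
    omega
  rw [h2]
  simp

theorem stmt_3 (k n : ℕ) (hk : 1 < k) (P : Finset ℝ) (hP : P.card = k)
    (r : ℕ) (hr : r = n % (k - 1))
    (V : Finset ℝ) (hV : V.card = n) :
    (V.powerset.filter
        (fun Q => ∃ a b : ℝ, 0 < a ∧ Q = P.image (fun x => a * x + b))).card
      ≤ (n - r) * (n + r + 1 - k) / (2 * (k - 1)) := by
  obtain ⟨m, rfl⟩ : ∃ m, k = m + 1 := ⟨k - 1, by omega⟩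
  simp only [Nat.add_sub_cancel] at hr ⊢
  have hm : 0 < m := by omega
  have hrm : r < m := hr ▸ Nat.mod_lt _ hm
  obtain ⟨q, hq⟩ : ∃ q, n = m * q + r := ⟨n / m, by rw [hr]; exact (Nat.div_add_mod n m).symm⟩
  obtain ⟨p, hpP, hp⟩ := aux_enum _ P hP
  set ρ : ℝ → ℕ := fun v => (V.filter (fun w => w < v)).card with hρ
  have ρmono : ∀ x ∈ V, ∀ y, x < y → ρ x < ρ y := by
    intro x hx y hxy
    apply Finset.card_lt_card
    rw [Finset.ssubset_iff_of_subset]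
    · exact ⟨x, by simp [hx, hxy], by simp⟩
    · intro w hw
      simp only [Finset.mem_filter] at hw ⊢
      exact ⟨hw.1, hw.2.trans hxy⟩
  have ρinj : ∀ x ∈ V, ∀ y ∈ V, ρ x = ρ y → x = y := by
    intro x hx y hy h
    rcases lt_trichotomy x y with h1 | h1 | h1
    · exact absurd h (ρmono x hx y h1).ne
    · exact h1
    · exact absurd h (ρmono y hy x h1).ne'
  have ρlt : ∀ x ∈ V, ρ x < n := by
    intro x hx
    rw [← hV]
    apply Finset.card_lt_card
    rw [Finset.ssubset_iff_of_subset (Finset.filter_subset _ _)]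
    exact ⟨x, hx, by simp⟩
  set τ : ℕ → ℕ := fun j => j * q + min j r with hτ
  have hτm : τ m = n := by simp only [hτ]; rw [min_eq_right hrm.le, hq]
  have hτs : ∀ j, τ (j + 1) - τ j = if j < r then q + 1 else q := by
    intro j
    simp only [hτ, Nat.add_mul]
    split_ifs <;> omega
  set T : Finset (Σ _ : ℕ, Σ _ : ℕ, ℕ) :=
    (Finset.range m).sigma (fun j => (Finset.Ico (τ j) (τ (j + 1))).sigma
      (fun t => Finset.Ico (τ j) t)) with hT
  have hTcard : T.card = m * (∑ i ∈ Finset.range q, i) + r * q := by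
    rw [← aux_sum m q r hrm, hT, Finset.card_sigma]
    refine Finset.sum_congr rfl fun j _ => ?_
    rw [Finset.card_sigma, Finset.sum_Ico_eq_sum_range, hτs]
    refine Finset.sum_congr rfl fun i _ => ?_
    simp
  have key : ∀ Q ∈ V.powerset.filter
        (fun Q => ∃ a b : ℝ, 0 < a ∧ Q = P.image (fun x => a * x + b)),
      ∃ z ∈ T, ∃ a b : ℝ, Q = P.image (fun x => a * x + b) ∧ z.1 < m ∧
        a * p z.1 + b ∈ V ∧ a * p (z.1 + 1) + b ∈ V ∧
        z.2.1 = ρ (a * p (z.1 + 1) + b) ∧ z.2.2 = ρ (a * p z.1 + b) := by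
    intro Q hQ
    simp only [Finset.mem_filter, Finset.mem_powerset] at hQ
    obtain ⟨hQV, a, b, ha, rfl⟩ := hQ
    have hin : ∀ i < m + 1, a * p i + b ∈ V := fun i hi =>
      hQV (Finset.mem_image_of_mem (fun x => a * x + b) (hpP i hi))
    have hex : ∃ j, j < m ∧ ρ (a * p (j + 1) + b) < τ (j + 1) := by
      refine ⟨m - 1, by omega, ?_⟩
      rw [Nat.sub_add_cancel hm, hτm]
      exact ρlt _ (hin m (by omega))
    obtain ⟨hj, hj2⟩ := Nat.find_spec hex
    have hmin := fun i => Nat.find_min hex (m := i)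
    generalize Nat.find hex = j at hj hj2 hmin
    have hlow : τ j ≤ ρ (a * p j + b) := by
      rcases j with _ | j
      · simp [hτ]
      · have := hmin j (by omega)
        by_contra hc
        exact this ⟨by omega, by omega⟩
    have hlt : ρ (a * p j + b) < ρ (a * p (j + 1) + b) := by
      apply ρmono _ (hin j (by omega))
      have := mul_lt_mul_of_pos_left (hp j (j + 1) (by omega) (by omega)) ha
      linarith
    refine ⟨⟨j, ρ (a * p (j + 1) + b), ρ (a * p j + b)⟩, ?_, a, b, rfl, hj,
      hin j (by omega), hin (j + 1) (by omega), rfl, rfl⟩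
    simp only [hT, Finset.mem_sigma, Finset.mem_range, Finset.mem_Ico]
    exact ⟨hj, ⟨by omega, hj2⟩, hlow, hlt⟩
  choose! F hFT A B hF using key
  have hcard := Finset.card_le_card_of_injOn F hFT (by
    intro Q hQ Q' hQ' hFF
    obtain ⟨h1, h2, h3, h4, h5, h6⟩ := hF Q hQ
    obtain ⟨h1', -, h3', h4', h5', h6'⟩ := hF Q' hQ'
    rw [← hFF] at h3' h4' h5' h6'
    have e1 := ρinj _ h3 _ h3' (h6.symm.trans h6')
    have e2 := ρinj _ h4 _ h4' (h5.symm.trans h5')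
    have hpl := hp (F Q).1 ((F Q).1 + 1) (by omega) (by omega)
    have e3 : (A Q - A Q') * (p ((F Q).1 + 1) - p (F Q).1) = 0 := by linarith
    have eA : A Q = A Q' := by
      rcases mul_eq_zero.mp e3 with h | h <;> linarith
    have eB : B Q = B Q' := by rw [eA] at e1; linarith
    rw [h1, h1', eA, eB])
  refine hcard.trans ?_
  rw [hTcard, Nat.le_div_iff_mul_le (by omega)]
  have hg := Finset.sum_range_id_mul_two q
  rcases q with _ | q
  · simp
  · have e1 : n - r = m * (q + 1) := by omega
    have e2 : n + r + 1 - (m + 1) = m * q + 2 * r := by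
      rw [Nat.mul_add] at hq; omega
    rw [e1, e2]
    simp only [Nat.add_sub_cancel] at hg
    apply le_of_eq
    linear_combination m * m * hg
end

section
/- Let P be a finite k-element subset of ℝ whose pairwise distances are all commensurable (rationally related), and let ℓ be the minimal number of terms of an arithmetic progression containing a set directly similar to P. Then for every n, the maximum number of directly similar copies of P in an n-point subset of ℝ is at least (n-s)(n+s-ℓ+1)/(2(ℓ-1)) and at most (n-r)(n+r-k+1)/(2(k-1)), where r and s are the remainders of n modulo k-1 and ℓ-1 respectively. -/
attribute [local instance] Classical.propDecidable

/-- `EmbedsInAP P m` : some set directly similar to `P` is contained in an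
`m`-term arithmetic progression. -/
def EmbedsInAP (P : Finset ℝ) (m : ℕ) : Prop :=
  ∃ a b : ℝ, 0 < a ∧ ∃ c d : ℝ, 0 < d ∧
    P.image (fun x => a * x + b) ⊆ (Finset.range m).image (fun i => c + (i : ℝ) * d)

theorem image_aff_inj (P : Finset ℝ) (hP : 1 < P.card) (a b a' b' : ℝ) (ha : 0 < a) (ha' : 0 < a')
    (h : P.image (fun x => a * x + b) = P.image (fun x => a' * x + b')) : a = a' ∧ b = b' := by
  have hne : P.Nonempty := Finset.card_pos.mp (by omega)
  have key : ∀ a b a' b' : ℝ, 0 < a → 0 < a' →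
      P.image (fun x => a * x + b) = P.image (fun x => a' * x + b') →
      a' * P.min' hne + b' ≤ a * P.min' hne + b ∧ a * P.max' hne + b ≤ a' * P.max' hne + b' := by
    intro a b a' b' ha ha' h
    constructor
    · have h1 : a * P.min' hne + b ∈ P.image (fun x => a' * x + b') := by
        rw [← h]; exact Finset.mem_image_of_mem (fun x => a * x + b) (P.min'_mem hne)
      obtain ⟨y, hy, hy2⟩ := Finset.mem_image.mp h1
      have := P.min'_le y hy
      have := mul_le_mul_of_nonneg_left this ha'.le
      linarith
    · have h1 : a * P.max' hne + b ∈ P.image (fun x => a' * x + b') := by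
        rw [← h]; exact Finset.mem_image_of_mem (fun x => a * x + b) (P.max'_mem hne)
      obtain ⟨y, hy, hy2⟩ := Finset.mem_image.mp h1
      have := P.le_max' y hy
      have := mul_le_mul_of_nonneg_left this ha'.le
      linarith
  obtain ⟨h1, h2⟩ := key a b a' b' ha ha' h
  obtain ⟨h3, h4⟩ := key a' b' a b ha' ha h.symm
  have hlt : P.min' hne < P.max' hne := Finset.min'_lt_max'_of_card P hP
  have h5 : (a - a') * (P.max' hne - P.min' hne) = 0 := by linarith
  have h6 : a = a' := by
    rcases mul_eq_zero.mp h5 with h | h <;> linarith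
  subst h6
  exact ⟨rfl, by linarith⟩

theorem lower_sum (q L s : ℕ) :
    2 * ∑ i ∈ Finset.range q, (i * L + s) = q * ((q - 1) * L + 2 * s) := by
  rw [Finset.sum_add_distrib, ← Finset.sum_mul]
  have := Finset.sum_range_id_mul_two q
  simp only [Finset.sum_const, Finset.card_range, smul_eq_mul]
  calc _ = ((∑ i ∈ Finset.range q, i) * 2) * L + 2 * (q * s) := by ring
    _ = _ := by rw [this]; ring

/-- the common value of the counting formula -/
theorem formula_eq (n m q r : ℕ) (hm : 0 < m) (hn : n = q * m + r) :
    (n - r) * (n + r + 1 - (m + 1)) = (q * ((q - 1) * m + 2 * r)) * m := by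
  have h1 : n - r = q * m := by omega
  rw [h1]
  rcases q with _ | q
  · simp
  · have : n + r + 1 - (m + 1) = q * m + 2 * r := by
      rw [hn, Nat.succ_mul]; omega
    rw [this, Nat.add_sub_cancel]; ring

theorem lower_part (k ℓ n : ℕ) (hk : 1 < k) (P : Finset ℝ) (hPcard : P.card = k)
    (henv : EmbedsInAP P ℓ) (s : ℕ) (hs : s = n % (ℓ - 1)) :
    ∃ V : Finset ℝ, V.card = n ∧
      (n - s) * (n + s + 1 - ℓ) / (2 * (ℓ - 1))
        ≤ ((V.powersetCard k).filter
            (fun Q => ∃ a b : ℝ, 0 < a ∧ Q = P.image (fun x => a * x + b))).card := by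
  obtain ⟨A, B, hA, c, d, hd, hsub0⟩ := henv
  have hsub : P.image (fun x => A * x + B) ⊆
      (Finset.range ℓ).image (fun i : ℕ => c + (i : ℝ) * d) := by
    intro y hy
    have h := hsub0 hy
    simp at h
    simpa using h
  clear hsub0
  have hinj : ∀ a b : ℝ, 0 < a → Function.Injective (fun x : ℝ => a * x + b) := by
    intro a b ha x y hxy
    have : a * x = a * y := by simpa using hxy
    exact mul_left_cancel₀ ha.ne' this
  have hl : k ≤ ℓ := by
    have h1 := Finset.card_le_card hsub
    rw [Finset.card_image_of_injective _ (hinj A B hA), hPcard] at h1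
    exact h1.trans (Finset.card_image_le.trans (by simp))
  obtain ⟨L, rfl⟩ : ∃ L, ℓ = L + 1 := ⟨ℓ - 1, by omega⟩
  have hL : 0 < L := by omega
  simp only [Nat.add_sub_cancel] at hs ⊢
  have hn : n = n / L * L + s := by rw [hs, mul_comm]; exact (Nat.div_add_mod n L).symm
  set q := n / L
  refine ⟨(Finset.range n).image (fun i : ℕ => (i : ℝ)), ?_, ?_⟩
  · rw [Finset.card_image_of_injective _ Nat.cast_injective, Finset.card_range]
  rw [formula_eq n L q s hL hn, Nat.mul_div_mul_right _ _ hL, ← lower_sum,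
    Nat.mul_div_cancel_left _ (by norm_num)]
  have hcard : ∑ i ∈ Finset.range q, (i * L + s) =
      ((Finset.range q).sigma (fun i => Finset.range (i * L + s))).card := by
    rw [Finset.card_sigma]; simp
  rw [hcard]
  apply Finset.card_le_card_of_injOn (fun t : (_ : ℕ) × ℕ =>
    P.image (fun x => ((q - t.1 : ℕ) : ℝ) * A / d * x +
      (((q - t.1 : ℕ) : ℝ) * (B - c) / d + (t.2 : ℝ))))
  · rintro ⟨i, b⟩ ht
    simp only [Finset.coe_sigma, Set.mem_sigma_iff, Finset.mem_coe, Finset.mem_range] at ht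
    obtain ⟨hi, hb⟩ := ht
    have hpos : 0 < ((q - i : ℕ) : ℝ) * A / d := by
      have : (0 : ℝ) < ((q - i : ℕ) : ℝ) := by exact_mod_cast (by omega : 0 < q - i)
      positivity
    simp only [Finset.mem_coe, Finset.mem_filter, Finset.mem_powersetCard]
    refine ⟨⟨?_, ?_⟩, _, _, hpos, rfl⟩
    · intro y hy
      obtain ⟨x, hx, rfl⟩ := Finset.mem_image.mp hy
      obtain ⟨j, hj, hj2⟩ := Finset.mem_image.mp (hsub (Finset.mem_image_of_mem _ hx))
      refine Finset.mem_image.mpr ⟨(q - i) * j + b, ?_, ?_⟩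
      · rw [Finset.mem_range] at hj ⊢
        have h1 : (q - i) * j ≤ (q - i) * L := Nat.mul_le_mul_left _ (by omega)
        have h2 : (q - i) * L + i * L = q * L := by
          rw [← add_mul]; congr 1; omega
        omega
      · clear hy
        push_cast
        have h3 : (j : ℝ) = (A * x + B - c) / d := by
          rw [eq_div_iff hd.ne']; linarith
        rw [h3]; field_simp; ring
    · rw [Finset.card_image_of_injective _ (hinj _ _ hpos), hPcard]
  · rintro ⟨i, b⟩ ht ⟨i', b'⟩ ht' h
    simp only [Finset.coe_sigma, Set.mem_sigma_iff, Finset.mem_coe, Finset.mem_range] at ht ht'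
    have hpos : ∀ i < q, 0 < ((q - i : ℕ) : ℝ) * A / d := by
      intro i hi
      have : (0 : ℝ) < ((q - i : ℕ) : ℝ) := by exact_mod_cast (by omega : 0 < q - i)
      positivity
    obtain ⟨h1, h2⟩ := image_aff_inj P (by omega) _ _ _ _ (hpos i ht.1) (hpos i' ht'.1) h
    have h3 : ((q - i : ℕ) : ℝ) = ((q - i' : ℕ) : ℝ) := by
      rw [div_left_inj' hd.ne'] at h1
      exact mul_right_cancel₀ hA.ne' h1
    have h4 : q - i = q - i' := by exact_mod_cast h3
    have h5 : i = i' := by omega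
    subst h5
    have h6 : b = b' := by
      have : (b : ℝ) = b' := by linarith
      exact_mod_cast this
    subst h6
    rfl

theorem upper_sum (m q r : ℕ) (hr : r < m) (t : ℕ → ℕ) (ht : ∀ i, t i = i * q + min i r) :
    2 * ∑ i ∈ Finset.range m, ∑ y ∈ Finset.Ico (t i) (t (i + 1)), (y - t i)
      = q * ((q - 1) * m + 2 * r) := by
  have h1 : ∀ i, 2 * ∑ y ∈ Finset.Ico (t i) (t (i + 1)), (y - t i)
      = q * (q - 1) + if i < r then 2 * q else 0 := by
    intro i
    rw [Finset.sum_Ico_eq_sum_range]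
    simp only [Nat.add_sub_cancel_left]
    rw [mul_comm, Finset.sum_range_id_mul_two]
    have : t (i + 1) - t i = q + if i < r then 1 else 0 := by
      rw [ht, ht, Nat.succ_mul]
      split_ifs <;> omega
    rw [this]
    split_ifs
    · rcases q with _ | q
      · simp
      · simp; ring
    · simp
  rw [Finset.mul_sum, Finset.sum_congr rfl (fun i _ => h1 i), Finset.sum_add_distrib,
    ← Finset.sum_filter]
  have h2 : (Finset.range m).filter (fun i => i < r) = Finset.range r := by
    ext i; simp; omega
  rw [h2]
  simp
  ring

theorem upper_part (k n : ℕ) (hk : 1 < k) (P : Finset ℝ) (hPcard : P.card = k)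
    (r : ℕ) (hr : r = n % (k - 1)) (V : Finset ℝ) (hV : V.card = n) :
      ((V.powersetCard k).filter
          (fun Q => ∃ a b : ℝ, 0 < a ∧ Q = P.image (fun x => a * x + b))).card
        ≤ (n - r) * (n + r + 1 - k) / (2 * (k - 1)) := by
  obtain ⟨m, rfl⟩ : ∃ m, k = m + 1 := ⟨k - 1, by omega⟩
  have hm : 0 < m := by omega
  simp only [Nat.add_sub_cancel] at hr ⊢
  have hn : n = n / m * m + r := by rw [hr, mul_comm]; exact (Nat.div_add_mod n m).symm
  have hrm : r < m := by rw [hr]; exact Nat.mod_lt _ hm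
  set q := n / m
  obtain ⟨t, ht⟩ : ∃ t : ℕ → ℕ, ∀ i, t i = i * q + min i r := ⟨_, fun _ => rfl⟩
  rw [formula_eq n m q r hm hn, Nat.mul_div_mul_right _ _ hm, ← upper_sum m q r hrm t ht,
    Nat.mul_div_cancel_left _ (by norm_num)]
  have hcard : ∑ i ∈ Finset.range m, ∑ y ∈ Finset.Ico (t i) (t (i + 1)), (y - t i) =
      ((Finset.range m).sigma (fun i => (Finset.Ico (t i) (t (i + 1))).sigma
        (fun y => Finset.Ico (t i) y))).card := by
    rw [Finset.card_sigma]
    refine Finset.sum_congr rfl (fun i _ => ?_)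
    rw [Finset.card_sigma]; simp
  rw [hcard]
  -- enumerate P
  obtain ⟨p, hpm, hpP⟩ : ∃ p : ℕ → ℝ, (∀ i j, i < j → j < m + 1 → p i < p j) ∧
      ∀ i < m + 1, p i ∈ P := by
    refine ⟨fun i => if h : i < m + 1 then P.orderEmbOfFin hPcard ⟨i, h⟩ else 0, ?_, ?_⟩
    · intro i j hij hj
      simp only [hj, hij.trans hj, dif_pos]
      exact (P.orderEmbOfFin hPcard).strictMono hij
    · intro i hi
      simp only [hi, dif_pos]
      exact P.orderEmbOfFin_mem hPcard _
  -- ranks in V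
  obtain ⟨v, hvV⟩ : ∃ ρ : ℝ → ℕ, (∀ x ∈ V, ρ x < n) ∧ (∀ x ∈ V, ∀ y ∈ V, x < y → ρ x < ρ y) := by
    refine ⟨fun x => (V.filter (fun z => z < x)).card, ?_, ?_⟩
    · intro x hx
      rw [← hV]
      exact Finset.card_lt_card (Finset.filter_ssubset.mpr ⟨x, hx, lt_irrefl x⟩)
    · intro x hx y hy hxy
      apply Finset.card_lt_card
      rw [Finset.ssubset_iff_of_subset]
      · exact ⟨x, by simp [hx, hxy], by simp⟩
      · intro z hz
        simp only [Finset.mem_filter] at hz ⊢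
        exact ⟨hz.1, hz.2.trans hxy⟩
  obtain ⟨hvn, hvm⟩ := hvV
  have hvinj : ∀ x ∈ V, ∀ y ∈ V, v x = v y → x = y := by
    intro x hx y hy h
    rcases lt_trichotomy x y with h1 | h1 | h1
    · have := hvm x hx y hy h1; omega
    · exact h1
    · have := hvm y hy x hx h1; omega
  apply Finset.card_le_card_of_forall_subsingleton
    (fun Q w => ∃ a b : ℝ, 0 < a ∧ Q = P.image (fun x => a * x + b) ∧
      v (a * p w.1 + b) = w.2.2 ∧ v (a * p (w.1 + 1) + b) = w.2.1)
  · intro Q hQ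
    simp only [Finset.mem_filter, Finset.mem_powersetCard] at hQ
    obtain ⟨⟨hQV, -⟩, a, b, ha, rfl⟩ := hQ
    have hmem : ∀ i < m + 1, a * p i + b ∈ V := fun i hi =>
      hQV (Finset.mem_image_of_mem (fun x => a * x + b) (hpP i hi))
    have hex : ∃ j, v (a * p j + b) < t j := by
      refine ⟨m, ?_⟩
      have := hvn _ (hmem m (by omega))
      have h2 : t m = n := by rw [ht, hn, mul_comm]; congr 1; omega
      omega
    have hjm : Nat.find hex ≤ m := by
      apply Nat.find_min'
      have := hvn _ (hmem m (by omega))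
      have h2 : t m = n := by rw [ht, hn, mul_comm]; congr 1; omega
      omega
    have hj := Nat.find_spec hex
    have hj0 : Nat.find hex ≠ 0 := by
      intro h0
      rw [h0, ht] at hj
      simp at hj
    obtain ⟨i, hi⟩ := Nat.exists_eq_succ_of_ne_zero hj0
    have hi2 := Nat.find_min hex (m := i) (by omega)
    rw [hi] at hj
    have hlt : v (a * p i + b) < v (a * p (i + 1) + b) := by
      apply hvm _ (hmem i (by omega)) _ (hmem (i + 1) (by omega))
      have := mul_lt_mul_of_pos_left (hpm i (i + 1) (by omega) (by omega)) ha
      linarith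
    refine ⟨⟨i, v (a * p (i + 1) + b), v (a * p i + b)⟩, ?_, a, b, ha, rfl, rfl, rfl⟩
    simp only [Finset.mem_sigma, Finset.mem_range, Finset.mem_Ico]
    simp only [Nat.succ_eq_add_one] at hj
    omega
  · rintro ⟨i, y, x⟩ hw Q hQ Q' hQ'
    simp only [Finset.mem_sigma, Finset.mem_range] at hw
    obtain ⟨hQ1, a, b, ha, rfl, h1, h2⟩ := hQ
    obtain ⟨hQ1', a', b', ha', rfl, h1', h2'⟩ := hQ'
    simp only [Finset.mem_filter, Finset.mem_powersetCard] at hQ1 hQ1'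
    simp only at h1 h2 h1' h2'
    have hmem : ∀ i < m + 1, a * p i + b ∈ V := fun i hi =>
      hQ1.1.1 (Finset.mem_image_of_mem (fun x => a * x + b) (hpP i hi))
    have hmem' : ∀ i < m + 1, a' * p i + b' ∈ V := fun i hi =>
      hQ1'.1.1 (Finset.mem_image_of_mem (fun x => a' * x + b') (hpP i hi))
    have e1 := hvinj _ (hmem i (by omega)) _ (hmem' i (by omega)) (h1.trans h1'.symm)
    have e2 := hvinj _ (hmem (i + 1) (by omega)) _ (hmem' (i + 1) (by omega)) (h2.trans h2'.symm)
    have hlt := hpm i (i + 1) (by omega) (by omega)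
    have h5 : (a - a') * (p (i + 1) - p i) = 0 := by linarith
    have h6 : a = a' := by
      rcases mul_eq_zero.mp h5 with h | h <;> linarith
    subst h6
    have h7 : b = b' := by linarith
    rw [h7]

theorem stmt_10 (k ℓ n : ℕ) (hk : 1 < k)
    (P : Finset ℝ) (hPcard : P.card = k)
    (hcomm : ∃ a b : ℝ, 0 < a ∧ ∀ x ∈ P, ∃ m : ℤ, a * x + b = (m : ℝ))
    (henv : EmbedsInAP P ℓ ∧ ∀ m : ℕ, EmbedsInAP P m → ℓ ≤ m)
    (r s : ℕ) (hr : r = n % (k - 1)) (hs : s = n % (ℓ - 1)) :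
    (∀ V : Finset ℝ, V.card = n →
      ((V.powersetCard k).filter
          (fun Q => ∃ a b : ℝ, 0 < a ∧ Q = P.image (fun x => a * x + b))).card
        ≤ (n - r) * (n + r + 1 - k) / (2 * (k - 1)))
    ∧
    (∃ V : Finset ℝ, V.card = n ∧
      (n - s) * (n + s + 1 - ℓ) / (2 * (ℓ - 1))
        ≤ ((V.powersetCard k).filter
            (fun Q => ∃ a b : ℝ, 0 < a ∧ Q = P.image (fun x => a * x + b))).card) := by
  
  exact ⟨fun V hV => upper_part k n hk P hPcard r hr V hV,
    lower_part k ℓ n hk P hPcard henv.1 s hs⟩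
end

section
/- For each positive integer k, let V ⊆ ℤ be the set V = {6a : 0 ≤ a ≤ 18k} ∪ {6a+1 : 12k ≤ a ≤ 24k-1} ∪ {6a+3 : 0 ≤ a ≤ 54k-2} ∪ {6a-1 : 12k ≤ a ≤ 24k-1}, which has n = 96k elements. Then the number of triples p₁ < p₂ < p₃ in V with (p₂-p₁)/(p₃-p₁) = 1/3 (i.e., subsets directly similar to {0,1,3}) is exactly 1728k² - 48k = (3n² - 8n)/16. -/
/-- Number of admissible middle indices for a given difference `t`. -/
def w (l1 h1 l2 h2 l3 h3 t : ℤ) : ℤ :=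
  max 0 (min (h1 + t) (min h2 (h3 - 2 * t)) - max (l1 + t) (max l2 (l3 - 2 * t)) + 1)

theorem lin (f : ℤ → ℤ) (A B α β : ℤ) (hAB : A ≤ B)
    (h : ∀ t, A ≤ t → t < B → f t = α * t + β) :
    2 * ∑ t ∈ Finset.Ico A B, f t = (B - A) * (α * (A + B - 1) + 2 * β) := by
  induction B, hAB using Int.leInduction with
  | base => simp
  | succ n hn ih =>
    have e : Finset.Ico A (n + 1) = insert n (Finset.Ico A n) := by
      ext x; simp only [Finset.mem_Ico, Finset.mem_insert]; omega
    rw [e, Finset.sum_insert (by simp), mul_add,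
      ih (fun t h1 h2 => h t h1 (by omega)), h n hn (by omega)]
    ring

theorem step (f : ℤ → ℤ) (A B C α β : ℤ) (hAB : A ≤ B) (hBC : B ≤ C)
    (h : ∀ t, A ≤ t → t < B → f t = α * t + β) :
    2 * ∑ t ∈ Finset.Ico A C, f t
      = (B - A) * (α * (A + B - 1) + 2 * β) + 2 * ∑ t ∈ Finset.Ico B C, f t := by
  rw [← lin f A B α β hAB h, ← Finset.Ico_union_Ico_eq_Ico hAB hBC,
    Finset.sum_union (Finset.Ico_disjoint_Ico_consecutive A B C), mul_add]

theorem cnt (l1 h1 l2 h2 l3 h3 T M : ℤ) (hM : h2 - l1 < M) :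
    2 * (∑ a ∈ Finset.Icc l1 h1, ∑ b ∈ Finset.Icc l2 h2,
      if T ≤ b - a ∧ l3 ≤ 3 * b - 2 * a ∧ 3 * b - 2 * a ≤ h3 then (1 : ℤ) else 0)
      = 2 * ∑ t ∈ Finset.Ico T M, w l1 h1 l2 h2 l3 h3 t := by
  congr 1
  rw [← Finset.sum_product', ← Finset.sum_filter, Finset.sum_const, nsmul_eq_mul, mul_one]
  have hw : ∀ t, w l1 h1 l2 h2 l3 h3 t =
      ((Finset.Icc (max (l1 + t) (max l2 (l3 - 2 * t)))
        (min (h1 + t) (min h2 (h3 - 2 * t)))).card : ℤ) := by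
    intro t
    rw [Int.card_Icc]; unfold w; omega
  simp only [hw]
  rw [← Nat.cast_sum, ← Finset.card_sigma]
  congr 1
  refine Finset.card_bij' (fun p _ => ⟨p.2 - p.1, p.2⟩) (fun s _ => (s.2 - s.1, s.2)) ?_ ?_ ?_ ?_
  · rintro ⟨a, b⟩ h
    simp only [Finset.mem_filter, Finset.mem_product, Finset.mem_Icc, Finset.mem_sigma,
      Finset.mem_Ico] at h ⊢
    omega
  · rintro ⟨t, b⟩ h
    simp only [Finset.mem_filter, Finset.mem_product, Finset.mem_Icc, Finset.mem_sigma,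
      Finset.mem_Ico] at h ⊢
    omega
  · rintro ⟨a, b⟩ h; simp
  · rintro ⟨a, b⟩ h; simp

theorem triples (V : Finset ℤ) [DecidablePred fun P : Finset ℤ => ∃ b a : ℤ, 0 < a ∧ P = {b, b + a, b + 3 * a}] :
    (((V.powersetCard 3).filter
        (fun P => ∃ b a : ℤ, 0 < a ∧ P = {b, b + a, b + 3 * a})).card : ℤ)
      = ∑ p ∈ V, ∑ q ∈ V, if p < q ∧ 3 * q - 2 * p ∈ V then (1 : ℤ) else 0 := by
  rw [← Finset.sum_product', ← Finset.sum_filter, Finset.sum_const, nsmul_eq_mul, mul_one]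
  congr 1
  symm
  refine Finset.card_bij (fun x _ => {x.1, x.2, 3 * x.2 - 2 * x.1}) ?_ ?_ ?_
  · rintro ⟨p, q⟩ h
    simp only [Finset.mem_filter, Finset.mem_product] at h
    obtain ⟨⟨hp, hq⟩, hlt, hr⟩ := h
    simp only [Finset.mem_filter, Finset.mem_powersetCard]
    refine ⟨⟨?_, ?_⟩, p, q - p, by omega, ?_⟩
    · intro x hx
      simp only [Finset.mem_insert, Finset.mem_singleton] at hx
      rcases hx with rfl | rfl | rfl <;> assumption
    · rw [Finset.card_eq_three]
      exact ⟨p, q, 3 * q - 2 * p, by omega, by omega, by omega, rfl⟩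
    · congr 2
      · ring
      · congr 1; ring
  · rintro ⟨p, q⟩ h ⟨p', q'⟩ h' e
    simp only [Finset.mem_filter, Finset.mem_product] at h h'
    simp only [Finset.ext_iff, Finset.mem_insert, Finset.mem_singleton] at e
    have e1 := (e p).1 (by simp)
    have e2 := (e q).1 (by simp)
    have e3 := (e (3 * q - 2 * p)).1 (by simp)
    have e4 := (e p').2 (by simp)
    simp only [Prod.mk.injEq]
    omega
  · intro P h
    simp only [Finset.mem_filter, Finset.mem_powersetCard] at h
    obtain ⟨⟨hs, _⟩, b, a, ha, rfl⟩ := h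
    have e : 3 * (b + a) - 2 * b = b + 3 * a := by ring
    refine ⟨(b, b + a), ?_, ?_⟩
    · simp only [Finset.mem_filter, Finset.mem_product, e]
      refine ⟨⟨hs (by simp), hs (by simp)⟩, by omega, hs (by simp)⟩
    · simp only [e]

/-- Sum over the four progressions. -/
theorem sumV (K : ℤ) (V : Finset ℤ)
    (hVdef : V =
      (Finset.Icc (0 : ℤ) (18 * K)).image (fun a => 6 * a) ∪
      (Finset.Icc (12 * K) (24 * K - 1)).image (fun a => 6 * a + 1) ∪
      (Finset.Icc (0 : ℤ) (54 * K - 2)).image (fun a => 6 * a + 3) ∪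
      (Finset.Icc (12 * K) (24 * K - 1)).image (fun a => 6 * a - 1)) (f : ℤ → ℤ) :
    ∑ x ∈ V, f x = ∑ a ∈ Finset.Icc 0 (18 * K), f (6 * a)
      + ∑ a ∈ Finset.Icc (12 * K) (24 * K - 1), f (6 * a + 1)
      + ∑ a ∈ Finset.Icc 0 (54 * K - 2), f (6 * a + 3)
      + ∑ a ∈ Finset.Icc (12 * K) (24 * K - 1), f (6 * a - 1) := by
  subst hVdef
  rw [Finset.sum_union, Finset.sum_union, Finset.sum_union, Finset.sum_image, Finset.sum_image,
    Finset.sum_image, Finset.sum_image]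
  any_goals
    intro x _ y _ h
    simp only at h
    omega
  all_goals
    rw [Finset.disjoint_left]
    intro x hx hy
    simp only [Finset.mem_union, Finset.mem_image] at hx hy
    omega

theorem memV (K : ℤ) (V : Finset ℤ)
    (hVdef : V =
      (Finset.Icc (0 : ℤ) (18 * K)).image (fun a => 6 * a) ∪
      (Finset.Icc (12 * K) (24 * K - 1)).image (fun a => 6 * a + 1) ∪
      (Finset.Icc (0 : ℤ) (54 * K - 2)).image (fun a => 6 * a + 3) ∪
      (Finset.Icc (12 * K) (24 * K - 1)).image (fun a => 6 * a - 1)) (x : ℤ) :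
    x ∈ V ↔ (x % 6 = 0 ∧ 0 ≤ x ∧ x ≤ 108 * K) ∨
      (x % 6 = 1 ∧ 72 * K + 1 ≤ x ∧ x ≤ 144 * K - 5) ∨
      (x % 6 = 3 ∧ 3 ≤ x ∧ x ≤ 324 * K - 9) ∨
      (x % 6 = 5 ∧ 72 * K - 1 ≤ x ∧ x ≤ 144 * K - 7) := by
  subst hVdef
  simp only [Finset.mem_union, Finset.mem_image, Finset.mem_Icc]
  constructor
  · rintro (((⟨a, h⟩ | ⟨a, h⟩) | ⟨a, h⟩) | ⟨a, h⟩) <;> omega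
  · rintro (h | h | h | h)
    · exact Or.inl (Or.inl (Or.inl ⟨x / 6, by omega⟩))
    · exact Or.inl (Or.inl (Or.inr ⟨x / 6, by omega⟩))
    · exact Or.inl (Or.inr ⟨x / 6, by omega⟩)
    · exact Or.inr ⟨x / 6 + 1, by omega⟩

theorem blk (I J : Finset ℤ) (P Q : ℤ → ℤ → Prop) [∀ a b, Decidable (P a b)]
    [∀ a b, Decidable (Q a b)] (h : ∀ a b, P a b ↔ Q a b) :
    (∑ a ∈ I, ∑ b ∈ J, if P a b then (1 : ℤ) else 0)
      = ∑ a ∈ I, ∑ b ∈ J, if Q a b then (1 : ℤ) else 0 := by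
  simp only [h]

set_option maxHeartbeats 4000000 in
theorem total (K : ℤ) (hK : 0 < K) (V : Finset ℤ)
    (hVdef : V =
      (Finset.Icc (0 : ℤ) (18 * K)).image (fun a => 6 * a) ∪
      (Finset.Icc (12 * K) (24 * K - 1)).image (fun a => 6 * a + 1) ∪
      (Finset.Icc (0 : ℤ) (54 * K - 2)).image (fun a => 6 * a + 3) ∪
      (Finset.Icc (12 * K) (24 * K - 1)).image (fun a => 6 * a - 1)) :
    (∑ p ∈ V, ∑ q ∈ V, if p < q ∧ 3 * q - 2 * p ∈ V then (1 : ℤ) else 0)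
      = 1728 * K ^ 2 - 48 * K := by
  -- residues 0, 0, 0
  have s0 := cnt 0 (18 * K) 0 (18 * K) (0 + (0)) ((18 * K) + (0)) 1 (60 * K) (by omega)
  rw [step _ 1 (6 * K + 1) (60 * K) (-3) (18 * K + 1) (by omega) (by omega) (by intro t h1 h2; unfold w; omega)] at s0
  rw [step _ (6 * K + 1) (60 * K) (60 * K) 0 0 (by omega) (by omega) (by intro t h1 h2; unfold w; omega)] at s0
  -- residues 3, 0, 0
  have s1 := cnt 0 (54 * K - 2) 0 (18 * K) (0 + (1)) ((18 * K) + (1)) 1 (60 * K) (by omega)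
  rw [step _ 1 (6 * K + 1) (60 * K) (-3) (18 * K + 2) (by omega) (by omega) (by intro t h1 h2; unfold w; omega)] at s1
  rw [step _ (6 * K + 1) (60 * K) (60 * K) 0 0 (by omega) (by omega) (by intro t h1 h2; unfold w; omega)] at s1
  -- residues 0, 1, 3
  have s2 := cnt 0 (18 * K) (12 * K) (24 * K - 1) (0 + (0)) ((54 * K - 2) + (0)) 0 (60 * K) (by omega)
  rw [step _ 0 (6 * K) (60 * K) (1) (6 * K + 1) (by omega) (by omega) (by intro t h1 h2; unfold w; omega)] at s2
  rw [step _ (6 * K) (12 * K + 1) (60 * K) (0) (12 * K) (by omega) (by omega) (by intro t h1 h2; unfold w; omega)] at s2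
  rw [step _ (12 * K + 1) (15 * K) (60 * K) (-1) (24 * K) (by omega) (by omega) (by intro t h1 h2; unfold w; omega)] at s2
  rw [step _ (15 * K) (18 * K) (60 * K) (-3) (54 * K - 1) (by omega) (by omega) (by intro t h1 h2; unfold w; omega)] at s2
  rw [step _ (18 * K) (60 * K) (60 * K) 0 0 (by omega) (by omega) (by intro t h1 h2; unfold w; omega)] at s2
  -- residues 1, 1, 1
  have s3 := cnt (12 * K) (24 * K - 1) (12 * K) (24 * K - 1) ((12 * K) + (0)) ((24 * K - 1) + (0)) 1 (60 * K) (by omega)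
  rw [step _ 1 (4 * K) (60 * K) (-3) (12 * K) (by omega) (by omega) (by intro t h1 h2; unfold w; omega)] at s3
  rw [step _ (4 * K) (60 * K) (60 * K) 0 0 (by omega) (by omega) (by intro t h1 h2; unfold w; omega)] at s3
  -- residues 3, 1, 3
  have s4 := cnt 0 (54 * K - 2) (12 * K) (24 * K - 1) (0 + (1)) ((54 * K - 2) + (1)) 1 (60 * K) (by omega)
  rw [step _ 1 (12 * K + 1) (60 * K) (0) (12 * K) (by omega) (by omega) (by intro t h1 h2; unfold w; omega)] at s4
  rw [step _ (12 * K + 1) (15 * K + 1) (60 * K) (-1) (24 * K) (by omega) (by omega) (by intro t h1 h2; unfold w; omega)] at s4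
  rw [step _ (15 * K + 1) (18 * K) (60 * K) (-3) (54 * K) (by omega) (by omega) (by intro t h1 h2; unfold w; omega)] at s4
  rw [step _ (18 * K) (60 * K) (60 * K) 0 0 (by omega) (by omega) (by intro t h1 h2; unfold w; omega)] at s4
  -- residues -1, 1, -1
  have s5 := cnt (12 * K) (24 * K - 1) (12 * K) (24 * K - 1) ((12 * K) + (-1)) ((24 * K - 1) + (-1)) 0 (60 * K) (by omega)
  rw [step _ 0 (4 * K) (60 * K) (-3) (12 * K - 1) (by omega) (by omega) (by intro t h1 h2; unfold w; omega)] at s5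
  rw [step _ (4 * K) (60 * K) (60 * K) 0 0 (by omega) (by omega) (by intro t h1 h2; unfold w; omega)] at s5
  -- residues 0, 3, 3
  have s6 := cnt 0 (18 * K) 0 (54 * K - 2) (0 + (-1)) ((54 * K - 2) + (-1)) 0 (60 * K) (by omega)
  rw [step _ 0 (12 * K) (60 * K) (0) (18 * K + 1) (by omega) (by omega) (by intro t h1 h2; unfold w; omega)] at s6
  rw [step _ (12 * K) (18 * K) (60 * K) (-3) (54 * K - 2) (by omega) (by omega) (by intro t h1 h2; unfold w; omega)] at s6
  rw [step _ (18 * K) (60 * K) (60 * K) 0 0 (by omega) (by omega) (by intro t h1 h2; unfold w; omega)] at s6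
  -- residues 1, 3, 1
  have s7 := cnt (12 * K) (24 * K - 1) 0 (54 * K - 2) ((12 * K) + (-1)) ((24 * K - 1) + (-1)) 0 (60 * K) (by omega)
  rw [step _ 0 (4 * K) (60 * K) (-3) (12 * K - 1) (by omega) (by omega) (by intro t h1 h2; unfold w; omega)] at s7
  rw [step _ (4 * K) (60 * K) (60 * K) 0 0 (by omega) (by omega) (by intro t h1 h2; unfold w; omega)] at s7
  -- residues 3, 3, 3
  have s8 := cnt 0 (54 * K - 2) 0 (54 * K - 2) (0 + (0)) ((54 * K - 2) + (0)) 1 (60 * K) (by omega)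
  rw [step _ 1 (18 * K) (60 * K) (-3) (54 * K - 1) (by omega) (by omega) (by intro t h1 h2; unfold w; omega)] at s8
  rw [step _ (18 * K) (60 * K) (60 * K) 0 0 (by omega) (by omega) (by intro t h1 h2; unfold w; omega)] at s8
  -- residues -1, 3, -1
  have s9 := cnt (12 * K) (24 * K - 1) 0 (54 * K - 2) ((12 * K) + (-2)) ((24 * K - 1) + (-2)) 0 (60 * K) (by omega)
  rw [step _ 0 (4 * K) (60 * K) (-3) (12 * K - 2) (by omega) (by omega) (by intro t h1 h2; unfold w; omega)] at s9
  rw [step _ (4 * K) (60 * K) (60 * K) 0 0 (by omega) (by omega) (by intro t h1 h2; unfold w; omega)] at s9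
  -- residues 0, -1, 3
  have s10 := cnt 0 (18 * K) (12 * K) (24 * K - 1) (0 + (1)) ((54 * K - 2) + (1)) 1 (60 * K) (by omega)
  rw [step _ 1 (6 * K) (60 * K) (1) (6 * K + 1) (by omega) (by omega) (by intro t h1 h2; unfold w; omega)] at s10
  rw [step _ (6 * K) (12 * K + 1) (60 * K) (0) (12 * K) (by omega) (by omega) (by intro t h1 h2; unfold w; omega)] at s10
  rw [step _ (12 * K + 1) (15 * K + 1) (60 * K) (-1) (24 * K) (by omega) (by omega) (by intro t h1 h2; unfold w; omega)] at s10
  rw [step _ (15 * K + 1) (18 * K) (60 * K) (-3) (54 * K) (by omega) (by omega) (by intro t h1 h2; unfold w; omega)] at s10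
  rw [step _ (18 * K) (60 * K) (60 * K) 0 0 (by omega) (by omega) (by intro t h1 h2; unfold w; omega)] at s10
  -- residues 1, -1, 1
  have s11 := cnt (12 * K) (24 * K - 1) (12 * K) (24 * K - 1) ((12 * K) + (1)) ((24 * K - 1) + (1)) 1 (60 * K) (by omega)
  rw [step _ 1 (4 * K + 1) (60 * K) (-3) (12 * K + 1) (by omega) (by omega) (by intro t h1 h2; unfold w; omega)] at s11
  rw [step _ (4 * K + 1) (60 * K) (60 * K) 0 0 (by omega) (by omega) (by intro t h1 h2; unfold w; omega)] at s11
  -- residues 3, -1, 3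
  have s12 := cnt 0 (54 * K - 2) (12 * K) (24 * K - 1) (0 + (2)) ((54 * K - 2) + (2)) 1 (60 * K) (by omega)
  rw [step _ 1 (12 * K + 1) (60 * K) (0) (12 * K) (by omega) (by omega) (by intro t h1 h2; unfold w; omega)] at s12
  rw [step _ (12 * K + 1) (15 * K + 1) (60 * K) (-1) (24 * K) (by omega) (by omega) (by intro t h1 h2; unfold w; omega)] at s12
  rw [step _ (15 * K + 1) (18 * K + 1) (60 * K) (-3) (54 * K + 1) (by omega) (by omega) (by intro t h1 h2; unfold w; omega)] at s12
  rw [step _ (18 * K + 1) (60 * K) (60 * K) 0 0 (by omega) (by omega) (by intro t h1 h2; unfold w; omega)] at s12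
  -- residues -1, -1, -1
  have s13 := cnt (12 * K) (24 * K - 1) (12 * K) (24 * K - 1) ((12 * K) + (0)) ((24 * K - 1) + (0)) 1 (60 * K) (by omega)
  rw [step _ 1 (4 * K) (60 * K) (-3) (12 * K) (by omega) (by omega) (by intro t h1 h2; unfold w; omega)] at s13
  rw [step _ (4 * K) (60 * K) (60 * K) 0 0 (by omega) (by omega) (by intro t h1 h2; unfold w; omega)] at s13
  have b0 := blk (Finset.Icc 0 (18 * K)) (Finset.Icc 0 (18 * K))
    (fun a b => 6 * a < 6 * b ∧ 3 * (6 * b) - 2 * (6 * a) ∈ V)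
    (fun a b => 1 ≤ b - a ∧ 0 + (0) ≤ 3 * b - 2 * a ∧ 3 * b - 2 * a ≤ (18 * K) + (0))
    (by intro a b; simp only [memV K V hVdef]; omega)
  have b1 := blk (Finset.Icc 0 (18 * K)) (Finset.Icc (12 * K) (24 * K - 1))
    (fun a b => 6 * a < 6 * b + 1 ∧ 3 * (6 * b + 1) - 2 * (6 * a) ∈ V)
    (fun a b => 0 ≤ b - a ∧ 0 + (0) ≤ 3 * b - 2 * a ∧ 3 * b - 2 * a ≤ (54 * K - 2) + (0))
    (by intro a b; simp only [memV K V hVdef]; omega)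
  have b2 := blk (Finset.Icc 0 (18 * K)) (Finset.Icc 0 (54 * K - 2))
    (fun a b => 6 * a < 6 * b + 3 ∧ 3 * (6 * b + 3) - 2 * (6 * a) ∈ V)
    (fun a b => 0 ≤ b - a ∧ 0 + (-1) ≤ 3 * b - 2 * a ∧ 3 * b - 2 * a ≤ (54 * K - 2) + (-1))
    (by intro a b; simp only [memV K V hVdef]; omega)
  have b3 := blk (Finset.Icc 0 (18 * K)) (Finset.Icc (12 * K) (24 * K - 1))
    (fun a b => 6 * a < 6 * b - 1 ∧ 3 * (6 * b - 1) - 2 * (6 * a) ∈ V)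
    (fun a b => 1 ≤ b - a ∧ 0 + (1) ≤ 3 * b - 2 * a ∧ 3 * b - 2 * a ≤ (54 * K - 2) + (1))
    (by intro a b; simp only [memV K V hVdef]; omega)
  have b4 := blk (Finset.Icc (12 * K) (24 * K - 1)) (Finset.Icc 0 (18 * K))
    (fun a b => 6 * a + 1 < 6 * b ∧ 3 * (6 * b) - 2 * (6 * a + 1) ∈ V)
    (fun a b => False)
    (by intro a b; simp only [memV K V hVdef]; refine iff_of_false ?_ not_false; omega)
  have b5 := blk (Finset.Icc (12 * K) (24 * K - 1)) (Finset.Icc (12 * K) (24 * K - 1))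
    (fun a b => 6 * a + 1 < 6 * b + 1 ∧ 3 * (6 * b + 1) - 2 * (6 * a + 1) ∈ V)
    (fun a b => 1 ≤ b - a ∧ (12 * K) + (0) ≤ 3 * b - 2 * a ∧ 3 * b - 2 * a ≤ (24 * K - 1) + (0))
    (by intro a b; simp only [memV K V hVdef]; omega)
  have b6 := blk (Finset.Icc (12 * K) (24 * K - 1)) (Finset.Icc 0 (54 * K - 2))
    (fun a b => 6 * a + 1 < 6 * b + 3 ∧ 3 * (6 * b + 3) - 2 * (6 * a + 1) ∈ V)
    (fun a b => 0 ≤ b - a ∧ (12 * K) + (-1) ≤ 3 * b - 2 * a ∧ 3 * b - 2 * a ≤ (24 * K - 1) + (-1))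
    (by intro a b; simp only [memV K V hVdef]; omega)
  have b7 := blk (Finset.Icc (12 * K) (24 * K - 1)) (Finset.Icc (12 * K) (24 * K - 1))
    (fun a b => 6 * a + 1 < 6 * b - 1 ∧ 3 * (6 * b - 1) - 2 * (6 * a + 1) ∈ V)
    (fun a b => 1 ≤ b - a ∧ (12 * K) + (1) ≤ 3 * b - 2 * a ∧ 3 * b - 2 * a ≤ (24 * K - 1) + (1))
    (by intro a b; simp only [memV K V hVdef]; omega)
  have b8 := blk (Finset.Icc 0 (54 * K - 2)) (Finset.Icc 0 (18 * K))
    (fun a b => 6 * a + 3 < 6 * b ∧ 3 * (6 * b) - 2 * (6 * a + 3) ∈ V)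
    (fun a b => 1 ≤ b - a ∧ 0 + (1) ≤ 3 * b - 2 * a ∧ 3 * b - 2 * a ≤ (18 * K) + (1))
    (by intro a b; simp only [memV K V hVdef]; omega)
  have b9 := blk (Finset.Icc 0 (54 * K - 2)) (Finset.Icc (12 * K) (24 * K - 1))
    (fun a b => 6 * a + 3 < 6 * b + 1 ∧ 3 * (6 * b + 1) - 2 * (6 * a + 3) ∈ V)
    (fun a b => 1 ≤ b - a ∧ 0 + (1) ≤ 3 * b - 2 * a ∧ 3 * b - 2 * a ≤ (54 * K - 2) + (1))
    (by intro a b; simp only [memV K V hVdef]; omega)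
  have b10 := blk (Finset.Icc 0 (54 * K - 2)) (Finset.Icc 0 (54 * K - 2))
    (fun a b => 6 * a + 3 < 6 * b + 3 ∧ 3 * (6 * b + 3) - 2 * (6 * a + 3) ∈ V)
    (fun a b => 1 ≤ b - a ∧ 0 + (0) ≤ 3 * b - 2 * a ∧ 3 * b - 2 * a ≤ (54 * K - 2) + (0))
    (by intro a b; simp only [memV K V hVdef]; omega)
  have b11 := blk (Finset.Icc 0 (54 * K - 2)) (Finset.Icc (12 * K) (24 * K - 1))
    (fun a b => 6 * a + 3 < 6 * b - 1 ∧ 3 * (6 * b - 1) - 2 * (6 * a + 3) ∈ V)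
    (fun a b => 1 ≤ b - a ∧ 0 + (2) ≤ 3 * b - 2 * a ∧ 3 * b - 2 * a ≤ (54 * K - 2) + (2))
    (by intro a b; simp only [memV K V hVdef]; omega)
  have b12 := blk (Finset.Icc (12 * K) (24 * K - 1)) (Finset.Icc 0 (18 * K))
    (fun a b => 6 * a - 1 < 6 * b ∧ 3 * (6 * b) - 2 * (6 * a - 1) ∈ V)
    (fun a b => False)
    (by intro a b; simp only [memV K V hVdef]; refine iff_of_false ?_ not_false; omega)
  have b13 := blk (Finset.Icc (12 * K) (24 * K - 1)) (Finset.Icc (12 * K) (24 * K - 1))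
    (fun a b => 6 * a - 1 < 6 * b + 1 ∧ 3 * (6 * b + 1) - 2 * (6 * a - 1) ∈ V)
    (fun a b => 0 ≤ b - a ∧ (12 * K) + (-1) ≤ 3 * b - 2 * a ∧ 3 * b - 2 * a ≤ (24 * K - 1) + (-1))
    (by intro a b; simp only [memV K V hVdef]; omega)
  have b14 := blk (Finset.Icc (12 * K) (24 * K - 1)) (Finset.Icc 0 (54 * K - 2))
    (fun a b => 6 * a - 1 < 6 * b + 3 ∧ 3 * (6 * b + 3) - 2 * (6 * a - 1) ∈ V)
    (fun a b => 0 ≤ b - a ∧ (12 * K) + (-2) ≤ 3 * b - 2 * a ∧ 3 * b - 2 * a ≤ (24 * K - 1) + (-2))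
    (by intro a b; simp only [memV K V hVdef]; omega)
  have b15 := blk (Finset.Icc (12 * K) (24 * K - 1)) (Finset.Icc (12 * K) (24 * K - 1))
    (fun a b => 6 * a - 1 < 6 * b - 1 ∧ 3 * (6 * b - 1) - 2 * (6 * a - 1) ∈ V)
    (fun a b => 1 ≤ b - a ∧ (12 * K) + (0) ≤ 3 * b - 2 * a ∧ 3 * b - 2 * a ≤ (24 * K - 1) + (0))
    (by intro a b; simp only [memV K V hVdef]; omega)
  simp only [sumV K V hVdef, Finset.sum_add_distrib]
  simp only [if_false, Finset.sum_const_zero] at b4 b12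
  rw [b0, b1, b2, b3, b4, b5, b6, b7, b8, b9, b10, b11, b12, b13, b14, b15]
  simp only [Finset.Ico_self, Finset.sum_empty] at s0 s1 s2 s3 s4 s5 s6 s7 s8 s9 s10 s11 s12 s13
  linarith

attribute [local instance] Classical.propDecidable

theorem stmt_18 (k : ℕ) (hk : 0 < k)
    (V : Finset ℤ)
    (hVdef : V =
      (Finset.Icc (0 : ℤ) (18 * k)).image (fun a => 6 * a) ∪
      (Finset.Icc (12 * (k : ℤ)) (24 * k - 1)).image (fun a => 6 * a + 1) ∪
      (Finset.Icc (0 : ℤ) (54 * k - 2)).image (fun a => 6 * a + 3) ∪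
      (Finset.Icc (12 * (k : ℤ)) (24 * k - 1)).image (fun a => 6 * a - 1)) :
    V.card = 96 * k ∧
    ((V.powersetCard 3).filter
        (fun P => ∃ b a : ℤ, 0 < a ∧ P = {b, b + a, b + 3 * a})).card
      = 1728 * k ^ 2 - 48 * k := by
  have hK : 0 < (k : ℤ) := by exact_mod_cast hk
  constructor
  · have h := sumV k V hVdef (fun _ => 1)
    simp only [Finset.sum_const, Int.card_Icc, nsmul_eq_mul, mul_one] at h
    omega
  · have h := (triples V).trans (total k hK V hVdef)
    have h2 : 48 * k ≤ 1728 * k ^ 2 := by nlinarith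
    zify [h2]
    convert h
end
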